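/- Let V be a U_q(f_m(K))-module with cyclic Whittaker vector w of type η. Then a vector v ∈ V is a Whittaker vector (Ev = η(E)v) if and only if v = uw for some u in the center Z(U_q(f_m(K))). -/

import Mathlib

noncomputable section

inductive UqGen : Type
  | E : UqGen
  | F : UqGen
  | K : UqGen
  | Kinv : UqGen

def lpow {A : Type*} [Monoid A] (x xinv : A) (n : ℤ) : A :=
  if 0 ≤ n then x ^ n.toNat else xinv ^ (-n).toNat

open FreeAlgebra in
inductive UqRel (q : ℂ) (m : ℕ) : FreeAlgebra ℂ UqGen → FreeAlgebra ℂ UqGen → Prop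
  | KE : UqRel q m (ι ℂ UqGen.K * ι ℂ UqGen.E) (q ^ 2 • (ι ℂ UqGen.E * ι ℂ UqGen.K))
  | KF : UqRel q m (ι ℂ UqGen.K * ι ℂ UqGen.F) ((q ^ 2)⁻¹ • (ι ℂ UqGen.F * ι ℂ UqGen.K))
  | KKinv : UqRel q m (ι ℂ UqGen.K * ι ℂ UqGen.Kinv) 1
  | KinvK : UqRel q m (ι ℂ UqGen.Kinv * ι ℂ UqGen.K) 1
  | EF : UqRel q m (ι ℂ UqGen.E * ι ℂ UqGen.F - ι ℂ UqGen.F * ι ℂ UqGen.E)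
      ((q - q⁻¹)⁻¹ • ((ι ℂ UqGen.K) ^ m - (ι ℂ UqGen.Kinv) ^ m))

abbrev Uq (q : ℂ) (m : ℕ) : Type := RingQuot (UqRel q m)

def Egen (q : ℂ) (m : ℕ) : Uq q m := RingQuot.mkAlgHom ℂ (UqRel q m) (FreeAlgebra.ι ℂ UqGen.E)
def Fgen (q : ℂ) (m : ℕ) : Uq q m := RingQuot.mkAlgHom ℂ (UqRel q m) (FreeAlgebra.ι ℂ UqGen.F)
def Kgen (q : ℂ) (m : ℕ) : Uq q m := RingQuot.mkAlgHom ℂ (UqRel q m) (FreeAlgebra.ι ℂ UqGen.K)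
def Kinvgen (q : ℂ) (m : ℕ) : Uq q m := RingQuot.mkAlgHom ℂ (UqRel q m) (FreeAlgebra.ι ℂ UqGen.Kinv)

def Kzpow (q : ℂ) (m : ℕ) (n : ℤ) : Uq q m := lpow (Kgen q m) (Kinvgen q m) n

def Casimir (q : ℂ) (m : ℕ) : Uq q m :=
  Fgen q m * Egen q m +
    (((q ^ (2 * m) - 1) * (q - q⁻¹))⁻¹ * q ^ (2 * m)) • Kgen q m ^ m +
    ((q ^ (2 * m) - 1) * (q - q⁻¹))⁻¹ • Kinvgen q m ^ m

section QuasiCommutation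

variable {A : Type*} [Ring A] [Algebra ℂ A]

theorem units_zpow_mul_of_quasiCommute {k : Aˣ} {x : A} {c : ℂ} (hc : c ≠ 0)
    (h : ↑k * x = c • (x * ↑k)) (n : ℤ) : ↑(k ^ n) * x = c ^ n • (x * ↑(k ^ n)) := by
  have h' : ↑k⁻¹ * x = c⁻¹ • (x * ↑k⁻¹) := by
    have h1 : x * ↑k⁻¹ = c • (↑k⁻¹ * x) := by
      calc x * ↑k⁻¹ = ↑k⁻¹ * (↑k * x) * ↑k⁻¹ := by simp
        _ = c • (↑k⁻¹ * x) := by simp [h, mul_assoc]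
    rw [h1, smul_smul, inv_mul_cancel₀ hc, one_smul]
  induction n using Int.induction_on with
  | zero => simp
  | succ n ih =>
    rw [zpow_add_one, Units.val_mul, mul_assoc, h, mul_smul_comm, ← mul_assoc, ih,
      smul_mul_assoc, smul_smul, mul_assoc, zpow_add_one₀ hc, mul_comm]
  | pred n ih =>
    rw [zpow_sub_one, Units.val_mul, mul_assoc, h', mul_smul_comm, ← mul_assoc, ih,
      smul_mul_assoc, smul_smul, mul_assoc, zpow_sub_one₀ hc, mul_comm]

theorem mul_units_zpow_of_quasiCommute {k : Aˣ} {x : A} {c : ℂ} (hc : c ≠ 0)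
    (h : ↑k * x = c • (x * ↑k)) (n : ℤ) : x * ↑(k ^ n) = (c ^ n)⁻¹ • (↑(k ^ n) * x) := by
  rw [units_zpow_mul_of_quasiCommute hc h, smul_smul, inv_mul_cancel₀ (zpow_ne_zero n hc),
    one_smul]

end QuasiCommutation

section Uq

variable (q : ℂ) (m : ℕ)

theorem Kgen_mul_Egen : Kgen q m * Egen q m = q ^ 2 • (Egen q m * Kgen q m) := by
  simpa [Kgen, Egen] using RingQuot.mkAlgHom_rel ℂ (UqRel.KE (q := q) (m := m))

theorem Kgen_mul_Fgen : Kgen q m * Fgen q m = (q ^ 2)⁻¹ • (Fgen q m * Kgen q m) := by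
  simpa only [Kgen, Fgen, map_mul, map_smul] using
    RingQuot.mkAlgHom_rel ℂ (UqRel.KF (q := q) (m := m))

theorem Kgen_mul_Kinvgen : Kgen q m * Kinvgen q m = 1 := by
  simpa [Kgen, Kinvgen] using RingQuot.mkAlgHom_rel ℂ (UqRel.KKinv (q := q) (m := m))

theorem Kinvgen_mul_Kgen : Kinvgen q m * Kgen q m = 1 := by
  simpa [Kgen, Kinvgen] using RingQuot.mkAlgHom_rel ℂ (UqRel.KinvK (q := q) (m := m))

theorem Egen_mul_Fgen : Egen q m * Fgen q m =
    Fgen q m * Egen q m + (q - q⁻¹)⁻¹ • (Kgen q m ^ m - Kinvgen q m ^ m) := by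
  rw [← sub_eq_iff_eq_add']
  simpa only [Kgen, Fgen, Egen, Kinvgen, map_mul, map_smul, map_sub, map_pow] using
    RingQuot.mkAlgHom_rel ℂ (UqRel.EF (q := q) (m := m))

/-- The generator `K` as a unit of the algebra. -/
def Kunit : (Uq q m)ˣ :=
  ⟨Kgen q m, Kinvgen q m, Kgen_mul_Kinvgen q m, Kinvgen_mul_Kgen q m⟩

theorem val_Kunit : ↑(Kunit q m) = Kgen q m := rfl

theorem val_inv_Kunit : ↑(Kunit q m)⁻¹ = Kinvgen q m := rfl

theorem val_Kunit_zpow_natCast (n : ℕ) : ↑(Kunit q m ^ (n : ℤ)) = Kgen q m ^ n := by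
  rw [zpow_natCast, Units.val_pow_eq_pow_val, val_Kunit]

theorem val_Kunit_zpow_neg_natCast (n : ℕ) : ↑(Kunit q m ^ (-n : ℤ)) = Kinvgen q m ^ n := by
  rw [zpow_neg, ← inv_zpow, zpow_natCast, Units.val_pow_eq_pow_val]
  rfl

theorem Uq_subalgebra_eq_top {S : Subalgebra ℂ (Uq q m)} (hE : Egen q m ∈ S)
    (hF : Fgen q m ∈ S) (hK : Kgen q m ∈ S) (hKinv : Kinvgen q m ∈ S) : S = ⊤ := by
  refine eq_top_iff.2 fun u _ => ?_
  obtain ⟨x, rfl⟩ := RingQuot.mkAlgHom_surjective ℂ (UqRel q m) u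
  induction x using FreeAlgebra.induction with
  | grade0 r => rw [AlgHom.commutes]; exact S.algebraMap_mem r
  | grade1 g => cases g <;> assumption
  | mul a b ha hb => rw [map_mul]; exact S.mul_mem (ha trivial) (hb trivial)
  | add a b ha hb => rw [map_add]; exact S.add_mem (ha trivial) (hb trivial)

variable {q}

theorem Egen_mul_Kunit_zpow (hq0 : q ≠ 0) (n : ℤ) : Egen q m * ↑(Kunit q m ^ n) =
    ((q ^ 2) ^ n)⁻¹ • (↑(Kunit q m ^ n) * Egen q m) :=
  mul_units_zpow_of_quasiCommute (pow_ne_zero 2 hq0) (Kgen_mul_Egen q m) n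

theorem Fgen_mul_Kunit_zpow (hq0 : q ≠ 0) (n : ℤ) : Fgen q m * ↑(Kunit q m ^ n) =
    (q ^ 2) ^ n • (↑(Kunit q m ^ n) * Fgen q m) := by
  simpa using mul_units_zpow_of_quasiCommute (inv_ne_zero (pow_ne_zero 2 hq0))
    (Kgen_mul_Fgen q m) n

theorem Casimir_eq_zpow : Casimir q m = Fgen q m * Egen q m +
    (((q ^ (2 * m) - 1) * (q - q⁻¹))⁻¹ * q ^ (2 * m)) • ↑(Kunit q m ^ (m : ℤ)) +
    ((q ^ (2 * m) - 1) * (q - q⁻¹))⁻¹ • ↑(Kunit q m ^ (-m : ℤ)) := by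
  rw [val_Kunit_zpow_natCast, val_Kunit_zpow_neg_natCast, Casimir]

theorem Casimir_commute_Egen (hq0 : q ≠ 0) (hqm : q ^ (2 * m) ≠ 1) :
    Casimir q m * Egen q m = Egen q m * Casimir q m := by
  have hEF := Egen_mul_Fgen q m
  rw [← val_Kunit_zpow_natCast, ← val_Kunit_zpow_neg_natCast] at hEF
  have hx : q ^ (2 * m) - 1 ≠ 0 := sub_ne_zero.2 hqm
  have hp : q ^ (2 * m) ≠ 0 := pow_ne_zero _ hq0
  have hz : (q ^ 2) ^ (m : ℤ) = q ^ (2 * m) := by rw [zpow_natCast, pow_mul]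
  have hz' : (q ^ 2) ^ (-m : ℤ) = (q ^ (2 * m))⁻¹ := by rw [zpow_neg, hz]
  rw [Casimir_eq_zpow, mul_add, mul_add, ← mul_assoc, hEF, mul_smul_comm, mul_smul_comm,
    Egen_mul_Kunit_zpow m hq0, Egen_mul_Kunit_zpow m hq0, hz, hz']
  simp only [add_mul, sub_mul, smul_mul_assoc, smul_sub]
  match_scalars <;> field_simp <;> ring

theorem Casimir_commute_Fgen (hq0 : q ≠ 0) (hqm : q ^ (2 * m) ≠ 1) :
    Casimir q m * Fgen q m = Fgen q m * Casimir q m := by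
  have hEF := Egen_mul_Fgen q m
  rw [← val_Kunit_zpow_natCast, ← val_Kunit_zpow_neg_natCast] at hEF
  have hx : q ^ (2 * m) - 1 ≠ 0 := sub_ne_zero.2 hqm
  have hp : q ^ (2 * m) ≠ 0 := pow_ne_zero _ hq0
  have hz : (q ^ 2) ^ (m : ℤ) = q ^ (2 * m) := by rw [zpow_natCast, pow_mul]
  have hz' : (q ^ 2) ^ (-m : ℤ) = (q ^ (2 * m))⁻¹ := by rw [zpow_neg, hz]
  rw [Casimir_eq_zpow, mul_add, mul_add, mul_smul_comm, mul_smul_comm, add_mul, add_mul,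
    mul_assoc, hEF, Fgen_mul_Kunit_zpow m hq0, Fgen_mul_Kunit_zpow m hq0, hz, hz']
  simp only [mul_add, mul_sub, smul_mul_assoc, mul_smul_comm, smul_sub]
  rw [Fgen_mul_Kunit_zpow m hq0, Fgen_mul_Kunit_zpow m hq0, hz, hz']
  match_scalars <;> field_simp <;> ring

theorem Kunit_zpow_commute_Casimir (hq0 : q ≠ 0) (n : ℤ) :
    ↑(Kunit q m ^ n) * Casimir q m = Casimir q m * ↑(Kunit q m ^ n) := by
  have hFE : ↑(Kunit q m ^ n) * (Fgen q m * Egen q m) =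
      Fgen q m * Egen q m * ↑(Kunit q m ^ n) := by
    rw [mul_assoc, Egen_mul_Kunit_zpow m hq0, mul_smul_comm, ← mul_assoc (Fgen q m),
      Fgen_mul_Kunit_zpow m hq0, smul_mul_assoc, smul_smul,
      inv_mul_cancel₀ (zpow_ne_zero n (pow_ne_zero 2 hq0)), one_smul, mul_assoc]
  have hKK (i : ℤ) : (↑(Kunit q m ^ n) : Uq q m) * ↑(Kunit q m ^ i) =
      ↑(Kunit q m ^ i) * ↑(Kunit q m ^ n) := by
    rw [← Units.val_mul, ← Units.val_mul, zpow_mul_comm]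
  rw [Casimir_eq_zpow, mul_add, mul_add, add_mul, add_mul, hFE, mul_smul_comm, mul_smul_comm,
    smul_mul_assoc, smul_mul_assoc, hKK, hKK]

theorem Casimir_mem_center (hq0 : q ≠ 0) (hqm : q ^ (2 * m) ≠ 1) :
    Casimir q m ∈ Subalgebra.center ℂ (Uq q m) := by
  have h : Subalgebra.centralizer ℂ {Casimir q m} = ⊤ := by
    apply Uq_subalgebra_eq_top <;> simp only [Subalgebra.mem_centralizer_iff, Set.mem_singleton_iff,
      forall_eq]
    · exact Casimir_commute_Egen m hq0 hqm
    · exact Casimir_commute_Fgen m hq0 hqm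
    · simpa [val_Kunit] using (Kunit_zpow_commute_Casimir m hq0 1).symm
    · simpa [val_inv_Kunit] using (Kunit_zpow_commute_Casimir m hq0 (-1)).symm
  refine Subalgebra.mem_center_iff.2 fun u => ?_
  have hu : u ∈ Subalgebra.centralizer ℂ {Casimir q m} := h ▸ Algebra.mem_top
  exact ((Subalgebra.mem_centralizer_iff ℂ).1 hu _ rfl).symm

section Module

variable {m} {V : Type*} [AddCommGroup V] [Module (Uq q m) V] [Module ℂ V]
  {w : V} {e : ℂ}

variable (q m) in
/-- The span of the vectors `z K ^ j w` with `z` central and `j` an integer. -/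
def centerZPowSpan (w : V) : Submodule ℂ V :=
  Submodule.span ℂ
    {v | ∃ z ∈ Subalgebra.center ℂ (Uq q m), ∃ j : ℤ, v = (z * ↑(Kunit q m ^ j)) • w}

theorem center_mul_zpow_smul_mem {z : Uq q m} (hz : z ∈ Subalgebra.center ℂ (Uq q m)) (j : ℤ)
    (w : V) : (z * ↑(Kunit q m ^ j)) • w ∈ centerZPowSpan q m w :=
  Submodule.subset_span ⟨z, hz, j, rfl⟩

theorem Kunit_zpow_smul_center_mul_zpow_mem (i : ℤ) {z : Uq q m}
    (hz : z ∈ Subalgebra.center ℂ (Uq q m)) (j : ℤ) (w : V) :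
    (↑(Kunit q m ^ i) : Uq q m) • (z * ↑(Kunit q m ^ j)) • w ∈ centerZPowSpan q m w := by
  rw [smul_smul, ← mul_assoc, Subalgebra.mem_center_iff.1 hz, mul_assoc, ← Units.val_mul,
    ← zpow_add]
  exact center_mul_zpow_smul_mem hz _ w

variable [IsScalarTower ℂ (Uq q m) V]

theorem Egen_smul_center_mul_zpow (hq0 : q ≠ 0) (hw : Egen q m • w = e • w) {z : Uq q m}
    (hz : z ∈ Subalgebra.center ℂ (Uq q m)) (j : ℤ) :
    Egen q m • (z * ↑(Kunit q m ^ j)) • w =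
      (((q ^ 2) ^ j)⁻¹ * e) • (z * ↑(Kunit q m ^ j)) • w := by
  rw [smul_smul, ← mul_assoc, Subalgebra.mem_center_iff.1 hz, mul_assoc,
    Egen_mul_Kunit_zpow m hq0, mul_smul_comm, smul_assoc, ← mul_assoc, mul_smul _ (Egen q m),
    hw, smul_comm _ e, smul_smul]

theorem Fgen_smul_whittaker (he : e ≠ 0) (hw : Egen q m • w = e • w) :
    Fgen q m • w = e⁻¹ • (Casimir q m -
      (((q ^ (2 * m) - 1) * (q - q⁻¹))⁻¹ * q ^ (2 * m)) • ↑(Kunit q m ^ (m : ℤ)) -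
      ((q ^ (2 * m) - 1) * (q - q⁻¹))⁻¹ • ↑(Kunit q m ^ (-m : ℤ)) : Uq q m) • w := by
  rw [Casimir_eq_zpow, add_sub_right_comm, add_sub_cancel_right, add_sub_cancel_right, mul_smul, hw,
    smul_comm (Fgen q m), smul_smul, inv_mul_cancel₀ he, one_smul]

theorem Fgen_smul_center_mul_zpow_mem (hq0 : q ≠ 0) (hqm : q ^ (2 * m) ≠ 1) (he : e ≠ 0)
    (hw : Egen q m • w = e • w) {z : Uq q m} (hz : z ∈ Subalgebra.center ℂ (Uq q m)) (j : ℤ) :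
    Fgen q m • (z * ↑(Kunit q m ^ j)) • w ∈ centerZPowSpan q m w := by
  rw [smul_smul, ← mul_assoc, Subalgebra.mem_center_iff.1 hz, mul_assoc,
    Fgen_mul_Kunit_zpow m hq0, mul_smul_comm, smul_assoc, ← mul_assoc, mul_smul _ (Fgen q m),
    Fgen_smul_whittaker he hw, smul_comm _ e⁻¹, smul_smul,
    smul_smul (_ : Uq q m)]
  refine Submodule.smul_mem _ _ ?_
  have hΩ := Casimir_mem_center m hq0 hqm
  rw [mul_sub, mul_sub, mul_smul_comm, mul_smul_comm, mul_assoc z, mul_assoc z, mul_assoc z,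
    ← Units.val_mul, ← Units.val_mul, ← zpow_add, ← zpow_add, Subalgebra.mem_center_iff.1 hΩ,
    ← mul_assoc z, sub_smul, sub_smul, smul_assoc, smul_assoc]
  exact sub_mem (sub_mem (center_mul_zpow_smul_mem (mul_mem hz hΩ) j w)
    (Submodule.smul_mem _ _ (center_mul_zpow_smul_mem hz _ w)))
    (Submodule.smul_mem _ _ (center_mul_zpow_smul_mem hz _ w))

theorem smul_mem_centerZPowSpan (hq0 : q ≠ 0) (hqm : q ^ (2 * m) ≠ 1) (he : e ≠ 0)
    (hw : Egen q m • w = e • w) (u : Uq q m) : u • w ∈ centerZPowSpan q m w := by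
  let S : Subalgebra ℂ (Uq q m) :=
    { carrier := {u | ∀ v ∈ centerZPowSpan q m w, u • v ∈ centerZPowSpan q m w}
      mul_mem' := fun {a b} ha hb v hv => by rw [mul_smul]; exact ha _ (hb v hv)
      add_mem' := fun {a b} ha hb v hv => by rw [add_smul]; exact add_mem (ha v hv) (hb v hv)
      algebraMap_mem' := fun r v hv => by
        rw [algebraMap_smul]; exact Submodule.smul_mem _ r hv }
  have key (u : Uq q m) (hu : ∀ z ∈ Subalgebra.center ℂ (Uq q m), ∀ j : ℤ,
      u • (z * ↑(Kunit q m ^ j)) • w ∈ centerZPowSpan q m w) : u ∈ S := by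
    intro v hv
    induction hv using Submodule.span_induction with
    | mem v hv => obtain ⟨z, hz, j, rfl⟩ := hv; exact hu z hz j
    | zero => rw [smul_zero]; exact zero_mem _
    | add x y _ _ hx hy => rw [smul_add]; exact add_mem hx hy
    | smul c x _ hx => rw [smul_comm]; exact Submodule.smul_mem _ c hx
  have hS : S = ⊤ := by
    apply Uq_subalgebra_eq_top
    · refine key _ fun z hz j => ?_
      rw [Egen_smul_center_mul_zpow hq0 hw hz]
      exact Submodule.smul_mem _ _ (center_mul_zpow_smul_mem hz j w)
    · exact key _ fun z hz j => Fgen_smul_center_mul_zpow_mem hq0 hqm he hw hz j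
    · refine key _ fun z hz j => ?_
      simpa [val_Kunit] using Kunit_zpow_smul_center_mul_zpow_mem 1 hz j w
    · refine key _ fun z hz j => ?_
      simpa [val_inv_Kunit] using Kunit_zpow_smul_center_mul_zpow_mem (-1) hz j w
  have hu : u ∈ S := hS ▸ Algebra.mem_top
  exact hu w (by simpa using center_mul_zpow_smul_mem (one_mem _) 0 w)

theorem exists_center_smul_of_whittaker (hm : 1 ≤ m) (hq0 : q ≠ 0)
    (hq : ∀ k : ℕ, 0 < k → q ^ k ≠ 1) (he : e ≠ 0) (hw : Egen q m • w = e • w)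
    (hcyc : ∀ v : V, ∃ u : Uq q m, v = u • w) {v : V} (hv : Egen q m • v = e • v) :
    ∃ u ∈ Subalgebra.center ℂ (Uq q m), v = u • w := by
  let T : Module.End ℂ V := Algebra.lsmul ℂ ℂ V (Egen q m)
  let Z : Submodule ℂ V := (Subalgebra.center ℂ (Uq q m)).toSubmodule.map
    ((LinearMap.toSpanSingleton (Uq q m) V w).restrictScalars ℂ)
  have hZ : Z ≤ T.eigenspace e := by
    rintro _ ⟨z, hz, rfl⟩
    rw [Module.End.mem_eigenspace_iff]
    simpa [T] using Egen_smul_center_mul_zpow hq0 hw hz 0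
  have hspan : centerZPowSpan q m w ≤ Z ⊔ ⨆ μ ≠ e, T.eigenspace μ := by
    refine Submodule.span_le.2 ?_
    rintro _ ⟨z, hz, j, rfl⟩
    rcases eq_or_ne j 0 with rfl | hj
    · exact Submodule.mem_sup_left ⟨z, hz, by simp⟩
    · have hne : ((q ^ 2) ^ j)⁻¹ * e ≠ e := by
        intro h
        have h1 : (q ^ 2) ^ j = 1 := inv_eq_one.1 (mul_right_cancel₀ he (h.trans (one_mul e).symm))
        have h2 : (q ^ 2) ^ j.natAbs = 1 := by
          obtain ⟨n, rfl | rfl⟩ := j.eq_nat_or_neg <;> simpa using h1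
        rw [← pow_mul] at h2
        exact hq _ (by positivity) h2
      refine Submodule.mem_sup_right (Submodule.mem_iSup_of_mem _
        (Submodule.mem_iSup_of_mem hne ?_))
      rw [Module.End.mem_eigenspace_iff]
      exact Egen_smul_center_mul_zpow hq0 hw hz j
  obtain ⟨u, hu⟩ := hcyc v
  obtain ⟨x, hx, y, hy, hxy⟩ := Submodule.mem_sup.1
    (hspan (hu ▸ smul_mem_centerZPowSpan hq0 (hq _ (by positivity)) he hw u))
  have hy0 : y = 0 := by
    refine Submodule.disjoint_def.1 (T.eigenspaces_iSupIndep e) y ?_ hy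
    rw [← add_sub_cancel_left x y, hxy]
    exact sub_mem (Module.End.mem_eigenspace_iff.2 hv) (hZ hx)
  obtain ⟨z, hz, rfl⟩ := hx
  exact ⟨z, hz, by rw [← hxy, hy0, add_zero]; rfl⟩

end Module

end Uq

/-- Let `V` be a `U_q(f_m(K))`-module with cyclic Whittaker vector `w`
of type `η` (where `e = η(E) ≠ 0`). Then `v ∈ V` is a Whittaker vector
(`Ev = η(E)v`) if and only if `v = uw` for some `u` in the center `Z(U_q(f_m(K)))`. -/
theorem stmt15 (q : ℂ) (m : ℕ) (hm : 1 ≤ m) (hq0 : q ≠ 0)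
    (hq : ∀ k : ℕ, 0 < k → q ^ k ≠ 1)
    (e : ℂ) (he : e ≠ 0)
    (V : Type) [AddCommGroup V] [Module (Uq q m) V]
    (w : V) (hw0 : w ≠ 0)
    (hw : Egen q m • w = algebraMap ℂ (Uq q m) e • w)
    (hcyc : ∀ v : V, ∃ u : Uq q m, v = u • w) :
    ∀ v : V, (Egen q m • v = algebraMap ℂ (Uq q m) e • v ↔
      ∃ u ∈ Subalgebra.center ℂ (Uq q m), v = u • w) := by
  let _ : Module ℂ V := Module.compHom V (algebraMap ℂ (Uq q m))
  have : IsScalarTower ℂ (Uq q m) V := ⟨fun c u v => by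
    rw [Algebra.smul_def, mul_smul]; rfl⟩
  intro v
  refine ⟨fun hv => exists_center_smul_of_whittaker hm hq0 hq he hw hcyc hv, ?_⟩
  rintro ⟨u, hu, rfl⟩
  rw [smul_smul, Subalgebra.mem_center_iff.1 hu, mul_smul, hw, smul_smul, smul_smul,
    Algebra.commutes]
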